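/- For all integers k ≥ 1 and r ≥ 1, the local antimagic chromatic number of the edge-corona product of the star S_k with the graph rK_2 equals 4; that is, χ_la(S_k ⋄ rK_2) = 4. -/

import Mathlib

/-!
Local antimagic (total) labelings and chromatic numbers, firecracker graphs,
stars, double stars, joins, and edge-corona products.
-/

open scoped Classical

noncomputable section

namespace LocalAntimagic

variable {V : Type*} [Fintype V]

/-- The weight of a vertex `u` under an edge labeling `f`: the sum of the
labels of the edges incident with `u`. -/
def weight (G : SimpleGraph V) (f : Sym2 V → ℕ) (u : V) : ℕ :=
  ∑ e ∈ G.edgeFinset, if u ∈ e then f e else 0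

/-- `f` is a local antimagic labeling of `G`: it maps the edge set of `G`
bijectively onto `{1, …, |E(G)|}` and adjacent vertices get distinct weights. -/
def IsLocalAntimagic (G : SimpleGraph V) (f : Sym2 V → ℕ) : Prop :=
  Set.BijOn f G.edgeSet (Set.Icc 1 G.edgeFinset.card) ∧
    ∀ u v, G.Adj u v → weight G f u ≠ weight G f v

/-- The number of distinct colors (vertex weights) induced by `f`. -/
def colorCount (G : SimpleGraph V) (f : Sym2 V → ℕ) : ℕ :=
  (Finset.univ.image (weight G f)).card

/-- The local antimagic chromatic number `χ_la(G)`: the least number of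
distinct induced colors over all local antimagic labelings of `G`. -/
def chiLA (G : SimpleGraph V) : ℕ :=
  sInf {c | ∃ f, IsLocalAntimagic G f ∧ colorCount G f = c}

/-- The total weight of a vertex `u` under a total labeling `(gv, ge)`:
`gv u` plus the sum of the labels of the edges incident with `u`. -/
def totalWeight (G : SimpleGraph V) (gv : V → ℕ) (ge : Sym2 V → ℕ) (u : V) : ℕ :=
  gv u + weight G ge u

/-- `(gv, ge)` is a local antimagic total labeling of `G`: together the vertex
labels and edge labels form a bijection from `V(G) ∪ E(G)` onto
`{1, …, |V(G)| + |E(G)|}`, and adjacent vertices get distinct total weights. -/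
def IsLocalAntimagicTotal (G : SimpleGraph V) (gv : V → ℕ) (ge : Sym2 V → ℕ) : Prop :=
  Set.BijOn (Sum.elim gv ge)
    (Set.range Sum.inl ∪ Sum.inr '' G.edgeSet)
    (Set.Icc 1 (Fintype.card V + G.edgeFinset.card)) ∧
    ∀ u v, G.Adj u v → totalWeight G gv ge u ≠ totalWeight G gv ge v

/-- The number of distinct colors (total vertex weights) induced by `(gv, ge)`. -/
def totalColorCount (G : SimpleGraph V) (gv : V → ℕ) (ge : Sym2 V → ℕ) : ℕ :=
  (Finset.univ.image (totalWeight G gv ge)).card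

/-- The local antimagic total chromatic number `χ_lat(G)`. -/
def chiLAT (G : SimpleGraph V) : ℕ :=
  sInf {c | ∃ gv ge, IsLocalAntimagicTotal G gv ge ∧ totalColorCount G gv ge = c}

/-- The star `S_k` with one center (`Sum.inl`) and `k` leaves (`Sum.inr`). -/
def star (k : ℕ) : SimpleGraph (Unit ⊕ Fin k) := completeBipartiteGraph Unit (Fin k)

/-- The matching `rK₂`: the disjoint union of `r` copies of `K₂`, i.e.
`(i, 0)` and `(i, 1)` are adjacent for each `i`, and nothing else. -/
def matching (r : ℕ) : SimpleGraph (Fin r × Fin 2) :=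
  SimpleGraph.fromRel (fun a b => a.1 = b.1)

/-- The edge-corona product `G ⋄ H`: take one copy of `G` and one disjoint
copy of `H` for each edge `e` of `G`, joining both endpoints of `e` to every
vertex of the copy of `H` assigned to `e`. -/
def edgeCorona {W : Type*} (G : SimpleGraph V) (H : SimpleGraph W) :
    SimpleGraph (V ⊕ (G.edgeSet × W)) :=
  SimpleGraph.fromRel (fun a b =>
    match a, b with
    | Sum.inl u, Sum.inl v => G.Adj u v
    | Sum.inl u, Sum.inr (e, _) => u ∈ (e : Sym2 V)
    | Sum.inr (e, w), Sum.inr (e', w') => e = e' ∧ H.Adj w w'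
    | _, _ => False)

/-! ### Arithmetic of the labels -/

/-- the order in which the copies `i` are traversed in block `j` -/
def sg (k r j i : ℕ) : ℕ := if j % 2 = 1 ∨ (j = 0 ∧ r % 2 = 0) then k - 1 - i else i

/-- labels of the five edges of block `j` in copy `i` -/
def lb (k r i j : ℕ) (t : Fin 5) : ℕ :=
  match t with
  | 0 => (r * k - k - j * k) + sg k r j i + 1
  | 1 => 2 * (r * k) + 2 * (j * k) + 2 * (k - 1 - sg k r j i) + 1
  | 2 => if j = 0 ∧ r % 2 = 0 then 2 * (r * k) + 2 * (j * k) + 2 * (k - 1 - sg k r j i) + 2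
      else r * k + (r * k - k - j * k) + sg k r j i + 1
  | 3 => 4 * (r * k) + (r * k - k - j * k) + sg k r j i + 1
  | 4 => if j = 0 ∧ r % 2 = 0 then r * k + (r * k - k - j * k) + sg k r j i + 1
      else 2 * (r * k) + 2 * (j * k) + 2 * (k - 1 - sg k r j i) + 2

/-- label of the star edge `i` -/
def lh (k r i : ℕ) : ℕ := 5 * (r * k) + i + 1

lemma sg_lt {k r j i : ℕ} (hi : i < k) : sg k r j i < k := by
  unfold sg; split_ifs <;> omega

lemma sg_inj {k r j i i' : ℕ} (hi : i < k) (hi' : i' < k) (h : sg k r j i = sg k r j i') :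
    i = i' := by
  unfold sg at h; split_ifs at h <;> omega

lemma jk_le {k r j : ℕ} (hj : j < r) : j * k + k ≤ r * k := by
  have : (j + 1) * k ≤ r * k := Nat.mul_le_mul_right k hj
  linarith [add_mul j 1 k]

lemma lb_bounds {k r i j : ℕ} (t : Fin 5) (hi : i < k) (hj : j < r) :
    1 ≤ lb k r i j t ∧ lb k r i j t ≤ 5 * (r * k) := by
  have h1 := jk_le (k := k) hj
  have h2 := sg_lt (r := r) (j := j) hi
  fin_cases t <;> simp only [lb] <;> (try split_ifs) <;> omega

lemma lb_inj {k r i j i' j' : ℕ} {t t' : Fin 5} (hi : i < k) (hj : j < r) (hi' : i' < k)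
    (hj' : j' < r) (h : lb k r i j t = lb k r i' j' t') : i = i' ∧ j = j' ∧ t = t' := by
  have h1 := jk_le (k := k) hj
  have h2 := sg_lt (r := r) (j := j) hi
  have h1' := jk_le (k := k) hj'
  have h2' := sg_lt (r := r) (j := j') hi'
  have h3 : j = j' ∧ sg k r j i = sg k r j' i' ∧ t = t' := by
    rcases lt_trichotomy j j' with hl | hl | hl
    · exfalso
      have h4 := jk_le (k := k) hl
      fin_cases t <;> fin_cases t' <;> simp only [lb] at h <;> (try split_ifs at h) <;> omega
    · subst hl
      refine ⟨rfl, ?_⟩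
      fin_cases t <;> fin_cases t' <;> simp only [lb] at h <;> (try split_ifs at h) <;>
        first
        | (exfalso; omega)
        | exact ⟨by omega, rfl⟩
    · exfalso
      have h4 := jk_le (k := k) hl
      fin_cases t <;> fin_cases t' <;> simp only [lb] at h <;> (try split_ifs at h) <;> omega
  obtain ⟨rfl, h5, rfl⟩ := h3
  exact ⟨sg_inj hi hi' h5, rfl, rfl⟩

lemma sum_x {k r i j : ℕ} (hi : i < k) (hj : j < r) :
    lb k r i j 0 + lb k r i j 1 + lb k r i j 3 = 8 * (r * k) + 1 := by
  have h1 := jk_le (k := k) hj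
  have h2 := sg_lt (r := r) (j := j) hi
  simp only [lb]; omega

lemma sum_y {k r i j : ℕ} (hi : i < k) (hj : j < r) :
    lb k r i j 0 + lb k r i j 2 + lb k r i j 4 = 5 * (r * k) + 2 := by
  have h1 := jk_le (k := k) hj
  have h2 := sg_lt (r := r) (j := j) hi
  simp only [lb]; split_ifs <;> omega

/-- slope of block `j` -/
def ep (r j : ℕ) : ℤ := (if j % 2 = 1 then 1 else -1) + (if j = 0 ∧ r % 2 = 0 then -1 else 0)

lemma sum_ep {r : ℕ} (hr : 1 ≤ r) : ∑ j : Fin r, ep r j = -1 := by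
  rw [Fin.sum_univ_eq_sum_range (fun j => ep r j)]
  unfold ep
  rw [Finset.sum_add_distrib]
  have h1 : ∀ n : ℕ, ∑ j ∈ Finset.range n, (if j % 2 = 1 then (1 : ℤ) else -1)
      = if n % 2 = 1 then -1 else 0 := by
    intro n
    induction n with
    | zero => simp
    | succ n ih =>
      rw [Finset.sum_range_succ, ih]
      split_ifs <;> omega
  have h2 : ∑ j ∈ Finset.range r, (if j = 0 ∧ r % 2 = 0 then (-1 : ℤ) else 0)
      = if r % 2 = 0 then -1 else 0 := by
    rw [Finset.sum_eq_single 0]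
    · simp
    · intro b _ hb; simp [hb]
    · intro h; simp at h; omega
  rw [h1, h2]
  split_ifs <;> omega

lemma v_slope {k r i j : ℕ} (hi : i < k) (hj : j < r) :
    ((lb k r i j 3 + lb k r i j 4 : ℕ) : ℤ) =
      ((lb k r 0 j 3 + lb k r 0 j 4 : ℕ) : ℤ) + ep r j * (i : ℤ) := by
  have h1 := jk_le (k := k) hj
  simp only [lb, ep, sg]
  by_cases a : j = 0 ∧ r % 2 = 0
  · obtain ⟨rfl, b⟩ := a
    simp [b]
    omega
  · by_cases c : j % 2 = 1
    · simp only [a, c]; simp; omega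
    · simp only [a, c]; simp; omega

/-- the weight of leaf `i` -/
def wv (k r i : ℕ) : ℕ := lh k r i + ∑ j : Fin r, (lb k r i j 3 + lb k r i j 4)

/-- the contribution of copy `i` to the weight of the center -/
def wc (k r i : ℕ) : ℕ := lh k r i + ∑ j : Fin r, (lb k r i j 1 + lb k r i j 2)

lemma wv_const {k r i : ℕ} (hr : 1 ≤ r) (hi : i < k) : wv k r i = wv k r 0 := by
  have h : ((wv k r i : ℕ) : ℤ) = (wv k r 0 : ℕ) := by
    unfold wv
    rw [Nat.cast_add, Nat.cast_add, Nat.cast_sum, Nat.cast_sum,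
      Finset.sum_congr rfl (fun j _ => v_slope hi j.2), Finset.sum_add_distrib,
      ← Finset.sum_mul, sum_ep hr]
    unfold lh
    push_cast
    ring
  exact_mod_cast h

lemma wv_big {k r : ℕ} (hk : 1 ≤ k) (hr : 1 ≤ r) : 8 * (r * k) + 1 < wv k r 0 := by
  have h := Finset.single_le_sum (f := fun j : Fin r => lb k r 0 j 3 + lb k r 0 j 4)
    (fun _ _ => Nat.zero_le _) (Finset.mem_univ ⟨0, hr⟩)
  have h2 : 4 * (r * k) + 1 ≤ lb k r 0 0 3 := by simp only [lb]; omega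
  unfold wv lh
  simp only at h
  omega

lemma wc_big {k r i : ℕ} (hr : 1 ≤ r) : 8 * (r * k) + 1 < wc k r i := by
  have h := Finset.single_le_sum (f := fun j : Fin r => lb k r i j 1 + lb k r i j 2)
    (fun _ _ => Nat.zero_le _) (Finset.mem_univ ⟨0, hr⟩)
  have h2 : 3 * (r * k) + 2 ≤ lb k r i 0 1 + lb k r i 0 2 := by
    simp only [lb]; split_ifs <;> omega
  unfold wc lh
  simp only at h
  omega

lemma wc_ne_wv {k r : ℕ} (hk : 1 ≤ k) (hr : 1 ≤ r) : ∑ i : Fin k, wc k r i ≠ wv k r 0 := by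
  rcases Nat.lt_or_ge 1 k with h | h
  · apply ne_of_gt
    have h1 : wc k r 0 + wc k r 1 ≤ ∑ i : Fin k, wc k r i := by
      have := Finset.sum_le_sum_of_subset (f := fun i : Fin k => wc k r i)
        (Finset.subset_univ {⟨0, hk⟩, ⟨1, h⟩})
      rw [Finset.sum_pair (by simp)] at this
      exact this
    have h2 : ∑ j : Fin r, (lb k r 0 j 3 + lb k r 0 j 4) ≤
        ∑ j : Fin r, ((lb k r 0 j 1 + lb k r 0 j 2) + (lb k r 1 j 1 + lb k r 1 j 2) + k) := by
      apply Finset.sum_le_sum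
      intro j _
      have h1 := jk_le (k := k) j.2
      have h2 := sg_lt (r := r) (j := j) hk
      have h3 := sg_lt (r := r) (j := j) h
      simp only [lb]
      split_ifs with hs
      · have : (j : ℕ) * k = 0 := by simp [hs.1]
        omega
      · omega
    simp only [Finset.sum_add_distrib, Finset.sum_const, Finset.card_univ, Fintype.card_fin, smul_eq_mul] at h2
    refine lt_of_lt_of_le ?_ h1
    unfold wv wc lh
    simp only [Finset.sum_add_distrib]
    omega
  · obtain rfl : k = 1 := by omega
    apply ne_of_lt
    simp only [Finset.univ_unique, Finset.sum_singleton, Fin.default_eq_zero, Fin.val_zero]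
    unfold wc wv
    apply Nat.add_lt_add_left
    have : Nonempty (Fin r) := ⟨⟨0, hr⟩⟩
    apply Finset.sum_lt_sum_of_nonempty Finset.univ_nonempty
    intro j _
    have h1 := jk_le (k := 1) j.2
    have h2 := sg_lt (r := r) (j := j) hk
    simp only [lb]
    split_ifs with hs
    · omega
    · omega

/-! ### The graph -/

/-- vertices of the edge-corona -/
abbrev VV (k r : ℕ) := (Unit ⊕ Fin k) ⊕ ((star k).edgeSet × (Fin r × Fin 2))

/-- the `i`th star edge -/
def se {k : ℕ} (i : Fin k) : (star k).edgeSet :=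
  ⟨s(Sum.inl (), Sum.inr i), by simp [star]⟩

lemma se_inj {k : ℕ} {i j : Fin k} : se i = se j ↔ i = j := by
  rw [Subtype.ext_iff]
  simp [se]

lemma se_surj {k : ℕ} (e : (star k).edgeSet) : ∃ i, e = se i := by
  obtain ⟨e, he⟩ := e
  induction e using Sym2.ind with
  | _ a b =>
    rcases a with a | a <;> rcases b with b | b <;> simp [star] at he
    · exact ⟨b, Subtype.ext rfl⟩
    · exact ⟨a, Subtype.ext Sym2.eq_swap⟩

/-- center -/
def vc {k r : ℕ} : VV k r := Sum.inl (Sum.inl ())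
/-- leaf -/
def vl {k r : ℕ} (i : Fin k) : VV k r := Sum.inl (Sum.inr i)
/-- corona vertices -/
def vx {k r : ℕ} (i : Fin k) (j : Fin r) (t : Fin 2) : VV k r := Sum.inr (se i, (j, t))

lemma vv_cases {k r : ℕ} (u : VV k r) :
    u = vc ∨ (∃ i, u = vl i) ∨ ∃ i j t, u = vx i j t := by
  rcases u with (u | i) | ⟨e, j, t⟩
  · exact Or.inl rfl
  · exact Or.inr (Or.inl ⟨i, rfl⟩)
  · obtain ⟨i, rfl⟩ := se_surj e
    exact Or.inr (Or.inr ⟨i, j, t, rfl⟩)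

lemma vl_inj {k r : ℕ} {i i' : Fin k} : (vl i : VV k r) = vl i' ↔ i = i' := by simp [vl]
lemma vx_inj {k r : ℕ} {i i' : Fin k} {j j' : Fin r} {t t' : Fin 2} :
    vx i j t = vx i' j' t' ↔ i = i' ∧ j = j' ∧ t = t' := by simp [vx, se_inj]
lemma vc_ne_vl {k r : ℕ} {i : Fin k} : (vc : VV k r) ≠ vl i := by simp [vc, vl]
lemma vc_ne_vx {k r : ℕ} {i : Fin k} {j : Fin r} {t : Fin 2} : vc ≠ vx i j t := by simp [vc, vx]
lemma vl_ne_vx {k r : ℕ} {i' i : Fin k} {j : Fin r} {t : Fin 2} : vl i' ≠ vx i j t := by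
  simp [vl, vx]
lemma vl_ne_vc {k r : ℕ} {i : Fin k} : (vl i : VV k r) ≠ vc := by simp [vc, vl]
lemma vx_ne_vc {k r : ℕ} {i : Fin k} {j : Fin r} {t : Fin 2} : vx i j t ≠ vc := by simp [vc, vx]
lemma vx_ne_vl {k r : ℕ} {i' i : Fin k} {j : Fin r} {t : Fin 2} : vx i j t ≠ vl i' := by
  simp [vl, vx]

/-- the graph -/
abbrev GG (k r : ℕ) : SimpleGraph (VV k r) := edgeCorona (star k) (matching r)

lemma adj_cl {k r : ℕ} (i : Fin k) : (GG k r).Adj vc (vl i) := by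
  simp [GG, edgeCorona, vc, vl, star]
lemma adj_cx {k r : ℕ} (i : Fin k) (j : Fin r) (t : Fin 2) : (GG k r).Adj vc (vx i j t) := by
  simp [GG, edgeCorona, vc, vx, se]
lemma adj_lx {k r : ℕ} (i' i : Fin k) (j : Fin r) (t : Fin 2) :
    (GG k r).Adj (vl i') (vx i j t) ↔ i' = i := by
  simp [GG, edgeCorona, vl, vx, se]
lemma adj_ll {k r : ℕ} (i' i : Fin k) : ¬ (GG k r).Adj (vl i') (vl i) := by
  simp [GG, edgeCorona, vl, star]
lemma adj_xx {k r : ℕ} (i' i : Fin k) (j' j : Fin r) (t' t : Fin 2) :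
    (GG k r).Adj (vx i' j' t') (vx i j t) ↔ i' = i ∧ j' = j ∧ t' ≠ t := by
  simp [GG, edgeCorona, vx, se_inj, matching]
  grind

lemma four_le {k r : ℕ} (hk : 1 ≤ k) (hr : 1 ≤ r) (f : Sym2 (VV k r) → ℕ)
    (hf : IsLocalAntimagic (GG k r) f) : 4 ≤ colorCount (GG k r) f := by
  let w := weight (GG k r) f
  let i : Fin k := ⟨0, hk⟩
  let j : Fin r := ⟨0, hr⟩
  have h1 : w vc ≠ w (vl i) := hf.2 _ _ (adj_cl i)
  have h2 : w vc ≠ w (vx i j 0) := hf.2 _ _ (adj_cx i j 0)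
  have h3 : w vc ≠ w (vx i j 1) := hf.2 _ _ (adj_cx i j 1)
  have h4 : w (vl i) ≠ w (vx i j 0) := hf.2 _ _ ((adj_lx i i j 0).2 rfl)
  have h5 : w (vl i) ≠ w (vx i j 1) := hf.2 _ _ ((adj_lx i i j 1).2 rfl)
  have h6 : w (vx i j 0) ≠ w (vx i j 1) := hf.2 _ _ ((adj_xx i i j j 0 1).2 ⟨rfl, rfl, by simp⟩)
  have hc : ({w vc, w (vl i), w (vx i j 0), w (vx i j 1)} : Finset ℕ).card = 4 := by
    rw [Finset.card_insert_of_notMem (by simp [h1, h2, h3]),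
      Finset.card_insert_of_notMem (by simp [h4, h5]), Finset.card_pair h6]
  unfold colorCount
  rw [← hc]
  apply Finset.card_le_card
  intro x hx
  simp only [Finset.mem_insert, Finset.mem_singleton] at hx
  rcases hx with rfl | rfl | rfl | rfl <;> exact Finset.mem_image_of_mem _ (Finset.mem_univ _)

/-- index type of the edges -/
abbrev EE (k r : ℕ) := Fin k ⊕ (Fin k × Fin r × Fin 5)

/-- ends of the edges of a block -/
def ed {k r : ℕ} (i : Fin k) (j : Fin r) (t : Fin 5) : Sym2 (VV k r) :=
  match t with
  | 0 => s(vx i j 0, vx i j 1)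
  | 1 => s(vc, vx i j 0)
  | 2 => s(vc, vx i j 1)
  | 3 => s(vl i, vx i j 0)
  | 4 => s(vl i, vx i j 1)

/-- the edges -/
def ph {k r : ℕ} : EE k r → Sym2 (VV k r)
  | Sum.inl i => s(vc, vl i)
  | Sum.inr (i, j, t) => ed i j t

/-- the labels -/
def ll {k r : ℕ} : EE k r → ℕ
  | Sum.inl i => lh k r i
  | Sum.inr (i, j, t) => lb k r i j t

lemma ph_inj {k r : ℕ} : Function.Injective (ph : EE k r → _) := by
  rintro (i | ⟨i, j, t⟩) (i' | ⟨i', j', t'⟩) h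
  · simp only [ph, Sym2.eq_iff, vl_inj, vc_ne_vl, false_and, or_false, true_and] at h
    rw [h]
  · exfalso
    fin_cases t' <;> simp [ph, ed, vl_inj, vx_inj, vc_ne_vl, vc_ne_vx, vl_ne_vc, vl_ne_vx,
      vx_ne_vl, vx_ne_vc] at h
  · exfalso
    fin_cases t <;> simp [ph, ed, vl_inj, vx_inj, vc_ne_vl, vc_ne_vx, vl_ne_vc, vl_ne_vx,
      vx_ne_vl, vx_ne_vc] at h
  · fin_cases t <;> fin_cases t' <;> simp [ph, ed, vl_inj, vx_inj, vc_ne_vl, vc_ne_vx, vl_ne_vc,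
      vl_ne_vx, vx_ne_vl, vx_ne_vc] at h ⊢ <;> simp [h]

lemma ph_mem {k r : ℕ} (x : EE k r) : ph x ∈ (GG k r).edgeSet := by
  rcases x with i | ⟨i, j, t⟩
  · exact adj_cl i
  · fin_cases t
    · exact (adj_xx i i j j 0 1).2 ⟨rfl, rfl, by simp⟩
    · exact adj_cx i j 0
    · exact adj_cx i j 1
    · exact (adj_lx i i j 0).2 rfl
    · exact (adj_lx i i j 1).2 rfl

lemma adj_ph {k r : ℕ} (u v : VV k r) (h : (GG k r).Adj u v) : ∃ x, ph x = s(u, v) := by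
  have cl : ∀ i : Fin k, ∃ x : EE k r, ph x = s(vc, vl i) := fun i => ⟨Sum.inl i, rfl⟩
  have cx : ∀ (i : Fin k) (j : Fin r) (t : Fin 2), ∃ x : EE k r, ph x = s(vc, vx i j t) := by
    intro i j t
    fin_cases t
    · exact ⟨Sum.inr (i, j, 1), rfl⟩
    · exact ⟨Sum.inr (i, j, 2), rfl⟩
  have lx : ∀ (i : Fin k) (j : Fin r) (t : Fin 2), ∃ x : EE k r, ph x = s(vl i, vx i j t) := by
    intro i j t
    fin_cases t
    · exact ⟨Sum.inr (i, j, 3), rfl⟩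
    · exact ⟨Sum.inr (i, j, 4), rfl⟩
  rcases vv_cases u with rfl | ⟨i, rfl⟩ | ⟨i, j, t, rfl⟩ <;>
    rcases vv_cases v with rfl | ⟨i', rfl⟩ | ⟨i', j', t', rfl⟩
  · exact absurd h (GG k r).irrefl
  · exact cl _
  · exact cx _ _ _
  · rw [Sym2.eq_swap]; exact cl _
  · exact absurd h (adj_ll _ _)
  · obtain rfl := (adj_lx _ _ _ _).1 h
    exact lx _ _ _
  · rw [Sym2.eq_swap]; exact cx _ _ _
  · obtain rfl := (adj_lx _ _ _ _).1 h.symm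
    rw [Sym2.eq_swap]; exact lx _ _ _
  · obtain ⟨rfl, rfl, ht⟩ := (adj_xx _ _ _ _ _ _).1 h
    fin_cases t <;> fin_cases t'
    · exact absurd rfl ht
    · exact ⟨Sum.inr (i, j, 0), rfl⟩
    · exact ⟨Sum.inr (i, j, 0), Sym2.eq_swap⟩
    · exact absurd rfl ht

lemma edges_eq {k r : ℕ} : (GG k r).edgeFinset = Finset.univ.map ⟨ph, ph_inj⟩ := by
  ext e
  simp only [SimpleGraph.mem_edgeFinset, Finset.mem_map, Finset.mem_univ, true_and,
    Function.Embedding.coeFn_mk]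
  constructor
  · induction e using Sym2.ind with
    | _ a b => exact fun h => adj_ph a b h
  · rintro ⟨x, rfl⟩
    exact ph_mem x

/-- the labeling -/
def lab (k r : ℕ) : Sym2 (VV k r) → ℕ := Function.extend ph ll (fun _ => 0)

lemma lab_ph {k r : ℕ} (x : EE k r) : lab k r (ph x) = ll x := ph_inj.extend_apply _ _ _

lemma ll_inj {k r : ℕ} : Function.Injective (ll : EE k r → ℕ) := by
  rintro (i | ⟨i, j, t⟩) (i' | ⟨i', j', t'⟩) h
  · simp only [ll, lh] at h
    congr 1; ext; omega
  · exfalso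
    have := lb_bounds t' i'.2 j'.2
    simp only [ll, lh] at h
    omega
  · exfalso
    have := lb_bounds t i.2 j.2
    simp only [ll, lh] at h
    omega
  · obtain ⟨h1, h2, rfl⟩ := lb_inj i.2 j.2 i'.2 j'.2 h
    rw [Fin.ext h1, Fin.ext h2]

lemma card_edges {k r : ℕ} : (GG k r).edgeFinset.card = 5 * (r * k) + k := by
  rw [edges_eq, Finset.card_map, Finset.card_univ]
  simp
  ring

lemma lab_bij {k r : ℕ} :
    Set.BijOn (lab k r) (GG k r).edgeSet (Set.Icc 1 (GG k r).edgeFinset.card) := by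
  have hm : Finset.univ.image (ll : EE k r → ℕ) = Finset.Icc 1 (5 * (r * k) + k) := by
    apply Finset.eq_of_subset_of_card_le
    · intro y hy
      obtain ⟨x, -, rfl⟩ := Finset.mem_image.1 hy
      rw [Finset.mem_Icc]
      rcases x with i | ⟨i, j, t⟩
      · have := i.2
        simp only [ll, lh]; omega
      · have := lb_bounds t i.2 j.2
        simp only [ll]; omega
    · rw [Finset.card_image_of_injective _ ll_inj, Finset.card_univ]
      simp
      apply le_of_eq
      ring
  have he : ∀ e ∈ (GG k r).edgeSet, ∃ x, ph x = e := by
    intro e he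
    induction e using Sym2.ind with
    | _ a b => exact adj_ph a b he
  rw [card_edges]
  refine ⟨?_, ?_, ?_⟩
  · intro e h
    obtain ⟨x, rfl⟩ := he e h
    rw [lab_ph, ← Finset.coe_Icc, ← hm]
    simp
  · intro e h e' h' hh
    obtain ⟨x, rfl⟩ := he e h
    obtain ⟨x', rfl⟩ := he e' h'
    rw [lab_ph, lab_ph] at hh
    rw [ll_inj hh]
  · intro y hy
    rw [← Finset.coe_Icc, ← hm] at hy
    obtain ⟨x, -, rfl⟩ := Finset.mem_image.1 hy
    exact ⟨ph x, ph_mem x, lab_ph x⟩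

lemma weight_eq {k r : ℕ} (u : VV k r) : weight (GG k r) (lab k r) u =
    (∑ i : Fin k, if u ∈ s(vc, vl i) then lh k r i else 0) +
    ∑ i : Fin k, ∑ j : Fin r, ∑ t : Fin 5, if u ∈ ed i j t then lb k r i j t else 0 := by
  unfold weight
  rw [edges_eq, Finset.sum_map, Fintype.sum_sum_type]
  simp only [Function.Embedding.coeFn_mk, lab_ph, Fintype.sum_prod_type]
  rfl

lemma weight_c {k r : ℕ} : weight (GG k r) (lab k r) vc = ∑ i : Fin k, wc k r i := by
  rw [weight_eq]
  simp [Fin.sum_univ_five, ed, vc_ne_vl, vc_ne_vx, wc, Finset.sum_add_distrib]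

lemma weight_l {k r : ℕ} (i : Fin k) : weight (GG k r) (lab k r) (vl i) = wv k r i := by
  rw [weight_eq]
  simp only [Fin.sum_univ_five, ed, vl_ne_vc, vl_ne_vx, Sym2.mem_iff, vl_inj, false_or, or_false,
    if_false, zero_add, add_zero, wv]
  rw [Finset.sum_ite_eq Finset.univ i, Finset.sum_eq_single i]
  · simp
  · intro b _ hb
    simp [hb.symm]
  · simp

lemma weight_x {k r : ℕ} (i : Fin k) (j : Fin r) :
    weight (GG k r) (lab k r) (vx i j 0) = 8 * (r * k) + 1 := by
  rw [weight_eq, ← sum_x i.2 j.2]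
  simp only [Fin.sum_univ_five, ed, vx_ne_vc, vx_ne_vl, Sym2.mem_iff, vx_inj, false_or, or_false,
    if_false, zero_add, Finset.sum_const_zero]
  rw [Finset.sum_eq_single i, Finset.sum_eq_single j]
  · simp
  · intro b _ hb
    simp [hb.symm]
  · simp
  · intro b _ hb
    simp [hb.symm]
  · simp

lemma weight_y {k r : ℕ} (i : Fin k) (j : Fin r) :
    weight (GG k r) (lab k r) (vx i j 1) = 5 * (r * k) + 2 := by
  rw [weight_eq, ← sum_y i.2 j.2]
  simp only [Fin.sum_univ_five, ed, vx_ne_vc, vx_ne_vl, Sym2.mem_iff, vx_inj, false_or, or_false,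
    if_false, zero_add, Finset.sum_const_zero]
  rw [Finset.sum_eq_single i, Finset.sum_eq_single j]
  · simp
  · intro b _ hb
    simp [hb.symm]
  · simp
  · intro b _ hb
    simp [hb.symm]
  · simp

lemma weight_x_cases {k r : ℕ} (i : Fin k) (j : Fin r) (t : Fin 2) :
    weight (GG k r) (lab k r) (vx i j t) = if t = 0 then 8 * (r * k) + 1 else 5 * (r * k) + 2 := by
  fin_cases t
  · exact weight_x i j
  · exact weight_y i j

lemma lab_isLA {k r : ℕ} (hk : 1 ≤ k) (hr : 1 ≤ r) : IsLocalAntimagic (GG k r) (lab k r) := by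
  refine ⟨lab_bij, ?_⟩
  have hR : 1 ≤ r * k := Nat.mul_pos hr hk
  have hcv := wc_ne_wv hk hr
  have hv := wv_big hk hr
  have hc : 8 * (r * k) + 1 < ∑ i : Fin k, wc k r i := by
    refine lt_of_lt_of_le (wc_big (i := 0) hr) ?_
    exact Finset.single_le_sum (f := fun i : Fin k => wc k r i)
      (fun _ _ => Nat.zero_le _) (Finset.mem_univ ⟨0, hk⟩)
  intro u v h
  rcases vv_cases u with rfl | ⟨i, rfl⟩ | ⟨i, j, t, rfl⟩ <;>
    rcases vv_cases v with rfl | ⟨i', rfl⟩ | ⟨i', j', t', rfl⟩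
  · exact absurd h (GG k r).irrefl
  · rw [weight_c, weight_l, wv_const hr i'.2]; exact hcv
  · rw [weight_c, weight_x_cases]; split_ifs <;> omega
  · rw [weight_c, weight_l, wv_const hr i.2]; exact hcv.symm
  · exact absurd h (adj_ll _ _)
  · rw [weight_l, wv_const hr i.2, weight_x_cases]; split_ifs <;> omega
  · rw [weight_c, weight_x_cases]; split_ifs <;> omega
  · rw [weight_l, wv_const hr i'.2, weight_x_cases]; split_ifs <;> omega
  · have ht := ((adj_xx _ _ _ _ _ _).1 h).2.2
    rw [weight_x_cases, weight_x_cases]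
    split_ifs <;> omega

lemma lab_count {k r : ℕ} (hk : 1 ≤ k) (hr : 1 ≤ r) : colorCount (GG k r) (lab k r) = 4 := by
  apply le_antisymm _ (four_le hk hr _ (lab_isLA hk hr))
  unfold colorCount
  refine (Finset.card_le_card (t := {∑ i : Fin k, wc k r i, wv k r 0, 8 * (r * k) + 1,
    5 * (r * k) + 2}) ?_).trans Finset.card_le_four
  intro y hy
  obtain ⟨u, -, rfl⟩ := Finset.mem_image.1 hy
  simp only [Finset.mem_insert, Finset.mem_singleton]
  rcases vv_cases u with rfl | ⟨i, rfl⟩ | ⟨i, j, t, rfl⟩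
  · rw [weight_c]; simp
  · rw [weight_l, wv_const hr i.2]; simp
  · rw [weight_x_cases]; split_ifs <;> simp

/-- For all integers `k ≥ 1` and `r ≥ 1`, the local antimagic chromatic number
of the edge-corona product of the star `S_k` with `rK₂` equals 4:
`χ_la(S_k ⋄ rK₂) = 4`. -/
theorem chiLA_star_edgeCorona_matching {k r : ℕ} (hk : 1 ≤ k) (hr : 1 ≤ r) :
    chiLA (edgeCorona (star k) (matching r)) = 4 := by
  have : Nonempty (Fin k) := ⟨⟨0, hk⟩⟩
  apply le_antisymm
  · exact Nat.sInf_le ⟨_, lab_isLA hk hr, lab_count hk hr⟩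
  · apply le_csInf
    · exact ⟨_, _, lab_isLA hk hr, rfl⟩
    · rintro c ⟨f, hf, rfl⟩
      exact four_le hk hr f hf

end LocalAntimagic
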